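/- arXiv:1609.01641 — 6 statements merged into one kernel-verified Lean document; each statement's English description precedes it below -/
import Mathlib

section
/- Let A be an n×n real matrix with nonnegative entries, B a diagonal matrix (bias factors) such that A' = B·A has nonnegative entries and strictly positive column sums, T a diagonal matrix with all diagonal entries τ_u ≥ 1 (delay factors), and D' the diagonal matrix of column sums of A' = B·A. Define the interaction matrix W = B·A + (T − I)·D' and let D_W be the diagonal matrix of column sums of W. Then D_W = T·D', the matrix W has nonnegative entries with strictly positive column sums, and the parametrized Laplacian satisfies the identity (D' − B·A)·(D'·T)^{-1} = (D_W − W)·D_W^{-1}. In particular, the dynamics generated by (D' − B·A)·(D'·T)^{-1} is equivalent to the unbiased random walk on the transformed graph W. -/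
/-- Layer transformation for a directed network: with bias diagonal `B`, delay diagonal
`T` (entries ≥ 1), `D'` the column-sum diagonal of `A' = B·A`, and interaction matrix
`W = B·A + (T − I)·D'`, we have `D_W = T·D'`, `W` is nonnegative with positive column
sums, and `(D' − B·A)·(D'·T)⁻¹ = (D_W − W)·D_W⁻¹`, i.e. the parametrized-Laplacian
dynamics is equivalent to the unbiased random walk on `W`. -/
theorem stmt_4 (n : ℕ) (A : Matrix (Fin n) (Fin n) ℝ) (b τ : Fin n → ℝ)
    (hA : ∀ v u, 0 ≤ A v u)
    (hA' : ∀ v u, 0 ≤ (Matrix.diagonal b * A) v u)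
    (hd' : ∀ u, 0 < ∑ v, (Matrix.diagonal b * A) v u)
    (hτ : ∀ u, 1 ≤ τ u)
    (D' : Matrix (Fin n) (Fin n) ℝ)
    (hD' : D' = Matrix.diagonal fun u => ∑ v, (Matrix.diagonal b * A) v u)
    (W : Matrix (Fin n) (Fin n) ℝ)
    (hW : W = Matrix.diagonal b * A + (Matrix.diagonal τ - 1) * D')
    (DW : Matrix (Fin n) (Fin n) ℝ)
    (hDW : DW = Matrix.diagonal fun u => ∑ v, W v u) :
    DW = Matrix.diagonal τ * D' ∧
    (∀ v u, 0 ≤ W v u) ∧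
    (∀ u, 0 < ∑ v, W v u) ∧
    (D' - Matrix.diagonal b * A) * (D' * Matrix.diagonal τ)⁻¹ = (DW - W) * DW⁻¹ := by
  generalize Matrix.diagonal b * A = M at *
  have hWM : W = M + Matrix.diagonal fun u => (τ u - 1) * ∑ v, M v u := by
    rw [hW, hD', ← Matrix.diagonal_one, Matrix.diagonal_sub, Matrix.diagonal_mul_diagonal]
  have hsum (u : Fin n) : ∑ v, W v u = τ u * ∑ v, M v u := by
    simp only [hWM, Matrix.add_apply, Finset.sum_add_distrib, Matrix.diagonal_apply,
      Finset.sum_ite_eq', Finset.mem_univ, if_true]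
    ring
  have hDWT : DW = Matrix.diagonal τ * D' := by
    rw [hDW, hD', Matrix.diagonal_mul_diagonal]
    exact congrArg Matrix.diagonal (funext hsum)
  have hcomm : D' * Matrix.diagonal τ = Matrix.diagonal τ * D' := by
    simp only [hD', Matrix.diagonal_mul_diagonal, mul_comm]
  refine ⟨hDWT, fun v u => ?_, fun u => ?_, ?_⟩
  · rw [hWM, Matrix.add_apply, Matrix.diagonal_apply]
    refine add_nonneg (hA' v u) ?_
    split_ifs
    · exact mul_nonneg (sub_nonneg.2 (hτ v)) (hd' v).le
    · exact le_rfl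
  · rw [hsum]
    exact mul_pos (zero_lt_one.trans_le (hτ u)) (hd' u)
  · rw [hcomm, hDWT, hW]
    congr 1
    rw [sub_mul, one_mul]
    abel
end

section
/- Let A be a symmetric n×n real matrix with nonnegative entries, B a diagonal matrix with strictly positive diagonal entries such that A' = B·A·B has strictly positive column sums, T a diagonal matrix with all diagonal entries τ_u ≥ 1, and D' the diagonal matrix of column sums of B·A·B. Define W = B·A·B + (T − I)·D' and let D_W be the diagonal matrix of column sums of W. Then W is symmetric with nonnegative entries and strictly positive column sums, D_W = T·D', and (D' − B·A·B)·(D'·T)^{-1} = (D_W − W)·D_W^{-1}. In particular, the dynamics ℒ = (D' − B·A·B)·(D'·T)^{-1} on an undirected network is equivalent to the unbiased random walk on the transformed undirected graph W. -/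
/-- Layer transformation for an undirected network: with symmetric nonnegative `A`,
positive bias diagonal `B`, delay diagonal `T` (entries ≥ 1), `D'` the column-sum
diagonal of `A' = B·A·B`, and `W = B·A·B + (T − I)·D'`, the matrix `W` is symmetric,
nonnegative, with positive column sums, `D_W = T·D'`, and
`(D' − B·A·B)·(D'·T)⁻¹ = (D_W − W)·D_W⁻¹`. -/
theorem stmt_5 (n : ℕ) (A : Matrix (Fin n) (Fin n) ℝ) (b τ : Fin n → ℝ)
    (hAsymm : A.IsSymm)
    (hA : ∀ v u, 0 ≤ A v u)
    (hb : ∀ u, 0 < b u)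
    (hd' : ∀ u, 0 < ∑ v, (Matrix.diagonal b * A * Matrix.diagonal b) v u)
    (hτ : ∀ u, 1 ≤ τ u)
    (D' : Matrix (Fin n) (Fin n) ℝ)
    (hD' : D' = Matrix.diagonal fun u => ∑ v, (Matrix.diagonal b * A * Matrix.diagonal b) v u)
    (W : Matrix (Fin n) (Fin n) ℝ)
    (hW : W = Matrix.diagonal b * A * Matrix.diagonal b + (Matrix.diagonal τ - 1) * D')
    (DW : Matrix (Fin n) (Fin n) ℝ)
    (hDW : DW = Matrix.diagonal fun u => ∑ v, W v u) :
    W.IsSymm ∧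
    (∀ v u, 0 ≤ W v u) ∧
    (∀ u, 0 < ∑ v, W v u) ∧
    DW = Matrix.diagonal τ * D' ∧
    (D' - Matrix.diagonal b * A * Matrix.diagonal b) * (D' * Matrix.diagonal τ)⁻¹ =
      (DW - W) * DW⁻¹ := by
  have hP_symm : (Matrix.diagonal b * A * Matrix.diagonal b).IsSymm := by
    simp [Matrix.IsSymm, Matrix.transpose_mul, hAsymm.eq, Matrix.mul_assoc]
  have hP_nonneg : ∀ v u, 0 ≤ (Matrix.diagonal b * A * Matrix.diagonal b) v u := by
    intro v u
    rw [Matrix.mul_diagonal, Matrix.diagonal_mul]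
    exact mul_nonneg (mul_nonneg (hb v).le (hA v u)) (hb u).le
  generalize Matrix.diagonal b * A * Matrix.diagonal b = P at *
  have hW' : W = P + Matrix.diagonal fun u => (τ u - 1) * ∑ v, P v u := by
    rw [hW, hD', ← Matrix.diagonal_one, Matrix.diagonal_sub, Matrix.diagonal_mul_diagonal]
  have hsum : ∀ u, ∑ v, W v u = τ u * ∑ v, P v u := by
    intro u
    simp only [hW', Matrix.add_apply, Finset.sum_add_distrib, Matrix.diagonal_apply,
      Finset.sum_ite_eq', Finset.mem_univ, if_true]
    ring
  have hDW' : DW = Matrix.diagonal τ * D' := by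
    simp only [hDW, hD', hsum, Matrix.diagonal_mul_diagonal]
  have hcomm : D' * Matrix.diagonal τ = DW := by
    simp only [hDW', hD', Matrix.diagonal_mul_diagonal, mul_comm]
  have hdiff : DW - W = D' - P := by
    rw [hDW', hW, sub_mul, one_mul]
    abel
  refine ⟨?_, fun v u => ?_, fun u => ?_, hDW', by rw [hcomm, hdiff]⟩
  · exact hW' ▸ hP_symm.add (Matrix.isSymm_diagonal _)
  · rw [hW', Matrix.add_apply, Matrix.diagonal_apply]
    refine add_nonneg (hP_nonneg v u) ?_
    split_ifs
    · exact mul_nonneg (sub_nonneg.mpr (hτ v)) (hd' v).le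
    · exact le_rfl
  · rw [hsum]
    exact mul_pos (one_pos.trans_le (hτ u)) (hd' u)
end

section
/- Let A be a symmetric n×n matrix with nonnegative entries and strictly positive column sums, and suppose the weighted graph of A is connected (for every pair of vertices u, v there is a path u = w_0, w_1, …, w_k = v with A_{w_{i+1}, w_i} > 0). If A'' is any symmetric n×n matrix with nonnegative entries and strictly positive column sums such that A''·D_{A''}^{-1} = A·D_A^{-1} (the two matrices define the same unbiased-random-walk transition matrix), then A'' = α·A for some scalar α > 0. In particular, for an undirected network the interaction matrix W = B·A·B + (T − I)·D' produced by the layer transformation is unique up to a global scaling factor among symmetric matrices realizing the same unbiased random walk. -/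
/-- The inverse of a diagonal matrix with nonzero diagonal entries. -/
theorem inv_diagonal_of_ne_zero {ι K : Type*} [Fintype ι] [DecidableEq ι] [Field K]
    {d : ι → K} (hd : ∀ i, d i ≠ 0) :
    (Matrix.diagonal d)⁻¹ = Matrix.diagonal fun i => (d i)⁻¹ := by
  apply Matrix.inv_eq_right_inv
  simp [Matrix.diagonal_mul_diagonal, mul_inv_cancel₀ (hd _)]

/-- If a symmetric connected weighted graph stays symmetric after rescaling its columns, then
all the scaling factors agree. -/
theorem column_scaling_eq_of_isSymm {ι : Type*} {A A' : Matrix ι ι ℝ} {r : ι → ℝ}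
    (hA : A.IsSymm) (hA' : A'.IsSymm) (h : ∀ v u, A' v u = r u * A v u) {u v : ι}
    (huv : Relation.ReflTransGen (fun a b => 0 < A b a) u v) : r u = r v := by
  induction huv with
  | refl => rfl
  | @tail b c _ hbc ih =>
    refine ih.trans (mul_right_cancel₀ hbc.ne' ?_)
    rw [← h c b, ← hA'.apply c b, h b c, hA.apply c b]


/-- For a connected undirected network `A` (symmetric, nonnegative, positive column
sums), any symmetric nonnegative matrix `A''` with positive column sums defining the
same unbiased-random-walk transition matrix is a positive scalar multiple of `A`:
the symmetric realization of a detailed-balanced random walk is unique up to a global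
scaling factor. -/
theorem stmt_6 (n : ℕ) (A : Matrix (Fin n) (Fin n) ℝ)
    (hAsymm : A.IsSymm)
    (hA : ∀ v u, 0 ≤ A v u)
    (hd : ∀ u, 0 < ∑ v, A v u)
    (hconn : ∀ u v : Fin n, Relation.ReflTransGen (fun a b => 0 < A b a) u v)
    (A'' : Matrix (Fin n) (Fin n) ℝ)
    (hA''symm : A''.IsSymm)
    (hA'' : ∀ v u, 0 ≤ A'' v u)
    (hd'' : ∀ u, 0 < ∑ v, A'' v u)
    (hsame : A'' * (Matrix.diagonal fun u => ∑ v, A'' v u)⁻¹ =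
      A * (Matrix.diagonal fun u => ∑ v, A v u)⁻¹) :
    ∃ α : ℝ, 0 < α ∧ A'' = α • A := by
  have hscale : ∀ v u, A'' v u = ((∑ w, A'' w u) / ∑ w, A w u) * A v u := by
    intro v u
    rw [inv_diagonal_of_ne_zero fun u => (hd u).ne',
      inv_diagonal_of_ne_zero fun u => (hd'' u).ne'] at hsame
    have hentry := congrFun (congrFun hsame v) u
    rw [Matrix.mul_diagonal, Matrix.mul_diagonal] at hentry
    have h₁ := (hd u).ne'
    have h₂ := (hd'' u).ne'
    field_simp at hentry ⊢
    linarith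
  rcases isEmpty_or_nonempty (Fin n) with hn | ⟨⟨i⟩⟩
  · exact ⟨1, one_pos, Subsingleton.elim _ _⟩
  · refine ⟨(∑ w, A'' w i) / ∑ w, A w i, div_pos (hd'' i) (hd i), ?_⟩
    ext v u
    rw [Matrix.smul_apply, smul_eq_mul, hscale v u]
    exact congrArg (· * A v u)
      (column_scaling_eq_of_isSymm (r := fun u => (∑ w, A'' w u) / ∑ w, A w u)
        hAsymm hA''symm hscale (hconn u i))
end

section
/- Let l ≥ 1, let d_1, …, d_l be strictly positive real numbers, and let M be an l×l column-stochastic matrix with nonnegative entries whose diagonal entries M_{ii} are all strictly positive. Then there exists a unique l×l matrix X with nonnegative entries and strictly positive column sums such that X_{ii} = d_i for every i and X·D_X^{-1} = M, where D_X is the diagonal matrix of column sums of X. Explicitly, X = M·Γ where Γ is the diagonal matrix with entries Γ_{ii} = d_i / M_{ii}, so X_{ij} = (M_{ij}/M_{jj})·d_j for i ≠ j. -/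
/-- Right multiplication by the inverse of an invertible diagonal matrix, entrywise. -/
theorem mul_inv_diagonal_eq_iff {m n K : Type*} [Fintype n] [DecidableEq n] [Field K]
    (X M : Matrix m n K) {v : n → K} (hv : ∀ j, v j ≠ 0) :
    X * (Matrix.diagonal v)⁻¹ = M ↔ ∀ i j, X i j = M i j * v j := by
  have hinv : (Matrix.diagonal v)⁻¹ = Matrix.diagonal fun j => (v j)⁻¹ :=
    Matrix.inv_eq_right_inv (by simp [Matrix.diagonal_mul_diagonal, hv])
  rw [hinv, ← Matrix.ext_iff]
  simp only [Matrix.mul_diagonal, ← div_eq_mul_inv, div_eq_iff (hv _)]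


/-- Given positive prescribed diagonal entries `d i` and an `l×l` column-stochastic
matrix `M` with positive diagonal, there is a unique nonnegative matrix `X` with
positive column sums, diagonal entries `X i i = d i`, and unbiased random walk
`X * D_X⁻¹ = M`; explicitly `X = M * Γ` with `Γ = diagonal (d i / M i i)`, so
`X i j = (M i j / M j j) * d j` for `i ≠ j`. -/
theorem stmt_7 (l : ℕ) (hl : 1 ≤ l) (d : Fin l → ℝ) (M : Matrix (Fin l) (Fin l) ℝ)
    (hd : ∀ i, 0 < d i)
    (hM : ∀ i j, 0 ≤ M i j)
    (hstoch : ∀ j, ∑ i, M i j = 1)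
    (hdiag : ∀ i, 0 < M i i) :
    (∃! X : Matrix (Fin l) (Fin l) ℝ,
      (∀ i j, 0 ≤ X i j) ∧ (∀ j, 0 < ∑ i, X i j) ∧ (∀ i, X i i = d i) ∧
        X * (Matrix.diagonal fun j => ∑ i, X i j)⁻¹ = M) ∧
    (let X₀ := M * Matrix.diagonal fun i => d i / M i i
     ((∀ i j, 0 ≤ X₀ i j) ∧ (∀ j, 0 < ∑ i, X₀ i j) ∧ (∀ i, X₀ i i = d i) ∧
        X₀ * (Matrix.diagonal fun j => ∑ i, X₀ i j)⁻¹ = M) ∧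
      ∀ i j, i ≠ j → X₀ i j = (M i j / M j j) * d j) := by
  have hsum (j : Fin l) :
      ∑ i, (M * Matrix.diagonal fun i => d i / M i i) i j = d j / M j j := by
    simp only [Matrix.mul_diagonal, ← Finset.sum_mul, hstoch, one_mul]
  have hpos (j : Fin l) : 0 < d j / M j j := div_pos (hd j) (hdiag j)
  have hX₀ : (∀ i j, 0 ≤ (M * Matrix.diagonal fun i => d i / M i i) i j) ∧
      (∀ j, 0 < ∑ i, (M * Matrix.diagonal fun i => d i / M i i) i j) ∧
      (∀ i, (M * Matrix.diagonal fun i => d i / M i i) i i = d i) ∧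
      (M * Matrix.diagonal fun i => d i / M i i) * (Matrix.diagonal fun j =>
        ∑ i, (M * Matrix.diagonal fun i => d i / M i i) i j)⁻¹ = M := by
    simp only [hsum]
    refine ⟨fun i j => ?_, hpos, fun i => ?_, ?_⟩
    · rw [Matrix.mul_diagonal]
      exact mul_nonneg (hM i j) (hpos j).le
    · rw [Matrix.mul_diagonal, mul_div_cancel₀ _ (hdiag i).ne']
    · rw [mul_inv_diagonal_eq_iff _ _ fun j => (hpos j).ne']
      exact fun i j => Matrix.mul_diagonal _ _ _ _
  refine ⟨⟨_, hX₀, ?_⟩, hX₀, fun i j _ => ?_⟩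
  · rintro X ⟨-, hXpos, hXdiag, hX⟩
    rw [mul_inv_diagonal_eq_iff _ _ fun j => (hXpos j).ne'] at hX
    ext i j
    rw [Matrix.mul_diagonal, hX i j, ← hXdiag j, hX j j,
      mul_div_cancel_left₀ _ (hdiag j).ne']
  · rw [Matrix.mul_diagonal, mul_div_assoc', div_mul_eq_mul_div]
end

section
/- Let l ≥ 1, n ≥ 1. For each layer i ∈ {1,…,l}, let W^i be an n×n matrix with nonnegative entries whose column sums d_u^i = Σ_v W^i_{v,u} are strictly positive for every vertex u. For each vertex u ∈ {1,…,n}, let M_u be an l×l column-stochastic matrix with nonnegative entries and strictly positive diagonal entries. Then there exists a unique (l·n)×(l·n) super-adjacency matrix 𝕎, written in l×l blocks of size n×n, satisfying: (1) the i-th diagonal block of 𝕎 equals W^i; (2) every off-diagonal block 𝕎^{ij} (i ≠ j) is an n×n diagonal matrix with nonnegative diagonal entries; and (3) for every vertex u, the l×l matrix X_u defined by (X_u)_{ii} = d_u^i and (X_u)_{ij} = (𝕎^{ij})_{u,u} for i ≠ j has strictly positive column sums and satisfies X_u·D_{X_u}^{-1} = M_u, where D_{X_u} is the diagonal matrix of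 column sums of X_u. Explicitly, the unique solution is (𝕎^{ij})_{u,u} = ((M_u)_{ij}/(M_u)_{jj})·d_u^j. -/
/-- A matrix `X` with positive diagonal has positive column sums and unbiased random walk `M`
if and only if each of its columns is the corresponding column of `M`, rescaled so that the
diagonal entries agree. -/
theorem randomWalk_eq_iff {ι : Type*} [Fintype ι] [DecidableEq ι] {X M : Matrix ι ι ℝ}
    (hX : ∀ j, 0 < X j j) (hstoch : ∀ j, ∑ i, M i j = 1) (hM : ∀ j, 0 < M j j) :
    ((∀ j, 0 < ∑ i, X i j) ∧ X * (Matrix.diagonal fun j => ∑ i, X i j)⁻¹ = M) ↔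
      ∀ i j, X i j = M i j / M j j * X j j := by
  have inv_diag (h : ∀ j, 0 < ∑ i, X i j) :
      (Matrix.diagonal fun j => ∑ i, X i j)⁻¹ = Matrix.diagonal fun j => (∑ i, X i j)⁻¹ := by
    refine Matrix.inv_eq_right_inv ?_
    rw [Matrix.diagonal_mul_diagonal, ← Matrix.diagonal_one]
    exact congrArg _ (funext fun j => mul_inv_cancel₀ (h j).ne')
  constructor
  · rintro ⟨hs, h⟩ i j
    rw [inv_diag hs] at h
    have hentry (i : ι) : X i j = M i j * ∑ k, X k j := by
      rw [← h, Matrix.mul_diagonal, inv_mul_cancel_right₀ (hs j).ne']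
    have hj := (hM j).ne'
    rw [hentry i, hentry j]
    field_simp
  · intro h
    have hsum (j : ι) : ∑ i, X i j = X j j / M j j := by
      rw [Finset.sum_congr rfl fun i _ => h i j, ← Finset.sum_mul, ← Finset.sum_div, hstoch]
      ring
    have hs (j : ι) : 0 < ∑ i, X i j := by
      rw [hsum]
      exact div_pos (hX j) (hM j)
    refine ⟨hs, ?_⟩
    rw [inv_diag hs]
    ext i j
    have hXj := (hX j).ne'
    have hMj := (hM j).ne'
    rw [Matrix.mul_diagonal, hsum, h i j]
    field_simp


/-- Unique feasible super-adjacency composition (Theorem: Layer + Ego consistency).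
Given `l` nonnegative layers `W i` with positive out-degrees and, for each vertex `u`,
a column-stochastic egocentric inter-layer matrix `M u` with positive diagonal, there
is a unique super-adjacency matrix `𝕎` (indexed by layer–vertex pairs) whose diagonal
blocks are the layers, whose off-diagonal blocks are nonnegative diagonal matrices,
and whose egocentric matrices `X_u` (diagonal `d_u^i`, off-diagonal the inter-layer
weights at `u`) have positive column sums and unbiased random walk `M u`. Explicitly,
`(𝕎^{ij})_{u,u} = ((M u)_{ij}/(M u)_{jj})·d_u^j` for `i ≠ j`. -/
theorem stmt_8 (l n : ℕ) (hl : 1 ≤ l) (hn : 1 ≤ n)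
    (W : Fin l → Matrix (Fin n) (Fin n) ℝ)
    (hW : ∀ i, ∀ v u, 0 ≤ W i v u)
    (hd : ∀ i, ∀ u : Fin n, 0 < ∑ v, W i v u)
    (M : Fin n → Matrix (Fin l) (Fin l) ℝ)
    (hM : ∀ u, ∀ i j, 0 ≤ M u i j)
    (hstoch : ∀ u, ∀ j, ∑ i, M u i j = 1)
    (hMdiag : ∀ u, ∀ i, 0 < M u i i) :
    let P : Matrix (Fin l × Fin n) (Fin l × Fin n) ℝ → Prop := fun 𝕎 =>
      -- (1) layer consistency: diagonal blocks are the input layers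
      (∀ i : Fin l, ∀ u v : Fin n, 𝕎 (i, u) (i, v) = W i u v) ∧
      -- (2) off-diagonal blocks are diagonal matrices with nonnegative entries
      (∀ i j : Fin l, i ≠ j → ∀ u v : Fin n, u ≠ v → 𝕎 (i, u) (j, v) = 0) ∧
      (∀ i j : Fin l, i ≠ j → ∀ u : Fin n, 0 ≤ 𝕎 (i, u) (j, u)) ∧
      -- (3) ego consistency for every vertex u
      (∀ u : Fin n,
        let X : Matrix (Fin l) (Fin l) ℝ :=
          fun i j => if i = j then ∑ v, W i v u else 𝕎 (i, u) (j, u)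
        (∀ j, 0 < ∑ i, X i j) ∧
        X * (Matrix.diagonal fun j => ∑ i, X i j)⁻¹ = M u)
    let 𝕎₀ : Matrix (Fin l × Fin n) (Fin l × Fin n) ℝ := fun p q =>
      if p.1 = q.1 then W p.1 p.2 q.2
      else if p.2 = q.2 then (M p.2 p.1 q.1 / M p.2 q.1 q.1) * ∑ v, W q.1 v p.2
      else 0
    P 𝕎₀ ∧ ∀ 𝕎, P 𝕎 → 𝕎 = 𝕎₀ := by
  intro P 𝕎₀
  have ego (u : Fin n) {X : Matrix (Fin l) (Fin l) ℝ} (hX : ∀ i, X i i = ∑ v, W i v u) :=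
    randomWalk_eq_iff (X := X) (fun i => hX i ▸ hd i u) (hstoch u) (hMdiag u)
  refine ⟨⟨fun i u v => by simp [𝕎₀], fun i j hij u v huv => by simp [𝕎₀, hij, huv],
    fun i j hij u => ?_, fun u => (ego u fun i => by simp).2 fun i j => ?_⟩, ?_⟩
  · simpa [𝕎₀, hij] using
      mul_nonneg (div_nonneg (hM u i j) (hMdiag u j).le) (hd j u).le
  · rcases eq_or_ne i j with rfl | hij
    · simp [(hMdiag u i).ne']
    · simp [𝕎₀, hij]
  · rintro 𝕎 ⟨hlayer, hdiag, -, hego⟩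
    ext ⟨i, u⟩ ⟨j, v⟩
    rcases eq_or_ne i j with rfl | hij
    · simp [𝕎₀, hlayer]
    rcases eq_or_ne u v with rfl | huv
    · simpa [𝕎₀, hij] using (ego u fun i => by simp).1 (hego u) i j
    · simp [𝕎₀, hij, huv, hdiag i j hij u v huv]
end

section
/- Let d^1, d^2 be strictly positive reals and let π^1 ∈ (0,1) with π^1 ≠ 1/2. Then the quantity x = (π^1·(d^1 + d^2) − d^1)/(1 − 2π^1) satisfies x ≥ 0 if and only if either 1/2 < π^1 ≤ d^1/(d^1 + d^2) or d^1/(d^1 + d^2) ≤ π^1 < 1/2. In other words, the two-layer undirected composition with prescribed inter-layer stationary distribution (π^1, 1 − π^1) is feasible (has a nonnegative inter-layer edge weight) exactly when π^1 lies between 1/2 and d^1/(d^1 + d^2). -/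
/-- Feasibility of the two-layer undirected composition with prescribed stationary
distribution: `x = (π¹·(d¹+d²) − d¹)/(1 − 2π¹)` is nonnegative iff `π¹` lies between
`1/2` and `d¹/(d¹+d²)`. -/
theorem stmt_10 (d1 d2 : ℝ) (hd1 : 0 < d1) (hd2 : 0 < d2)
    (π1 : ℝ) (hπ1 : 0 < π1) (hπ2 : π1 < 1) (hπhalf : π1 ≠ 1 / 2) :
    0 ≤ (π1 * (d1 + d2) - d1) / (1 - 2 * π1) ↔
      (1 / 2 < π1 ∧ π1 ≤ d1 / (d1 + d2)) ∨ (d1 / (d1 + d2) ≤ π1 ∧ π1 < 1 / 2) := by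
  have hd : 0 < d1 + d2 := add_pos hd1 hd2
  rw [le_div_iff₀ hd, div_le_iff₀ hd]
  rcases lt_or_gt_of_ne hπhalf with h | h
  · have hden : 0 < 1 - 2 * π1 := by linarith
    rw [le_div_iff₀ hden, zero_mul, sub_nonneg]
    simp only [h, h.not_gt, and_true, false_and, false_or]
  · have hden : 1 - 2 * π1 < 0 := by linarith
    rw [le_div_iff_of_neg hden, zero_mul, sub_nonpos]
    simp only [h, h.not_gt, true_and, and_false, or_false]
end
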